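/- Let (x, μ, λ) ∈ ℝⁿ × ℝᵐ × E be a KKT triple of problem (P1). Then (x, √(g(x)), μ, λ) is a KKT quadruple of problem (P2). -/

import Mathlib

open scoped RealInnerProductSpace

noncomputable section

/-- A Euclidean Jordan algebra structure on a finite-dimensional real inner
product space `E`: a commutative bilinear product `jmul` with unit, satisfying
the Jordan identity and compatibility with the inner product, together with the
spectral theorem (every element has a spectral decomposition along a Jordan
frame of size `rank`) and the normalization `⟪c, c⟫ = 1` for primitive
idempotents, which encodes that the inner product is the trace form. -/
structure EJA (E : Type*) [NormedAddCommGroup E] [InnerProductSpace ℝ E]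
    [FiniteDimensional ℝ E] where
  jmul : E →ₗ[ℝ] E →ₗ[ℝ] E
  comm : ∀ y z : E, jmul y z = jmul z y
  unit : E
  unit_jmul : ∀ y : E, jmul unit y = y
  jordan : ∀ y z : E, jmul y (jmul (jmul y y) z) = jmul (jmul y y) (jmul y z)
  assoc_inner : ∀ y z w : E, ⟪jmul y z, w⟫ = ⟪y, jmul z w⟫
  rank : ℕ
  spectral : ∀ y : E, ∃ (c : Fin rank → E) (σ : Fin rank → ℝ),
    (∀ i, jmul (c i) (c i) = c i) ∧
    (∀ i, c i ≠ 0) ∧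
    (∀ i, ∀ a b : E, jmul a a = a → jmul b b = b → a ≠ 0 → b ≠ 0 →
      jmul a b = 0 → c i ≠ a + b) ∧
    (∀ i j, i ≠ j → jmul (c i) (c j) = 0) ∧
    (∑ i, c i) = unit ∧
    y = ∑ i, σ i • c i
  inner_primitive : ∀ c : E, jmul c c = c → c ≠ 0 →
    (∀ a b : E, jmul a a = a → jmul b b = b → a ≠ 0 → b ≠ 0 →
      jmul a b = 0 → c ≠ a + b) →
    ⟪c, c⟫ = 1

namespace EJA

variable {E : Type*} [NormedAddCommGroup E] [InnerProductSpace ℝ E]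
  [FiniteDimensional ℝ E]

/-- `c` is an idempotent. -/
def IsIdempotent (J : EJA E) (c : E) : Prop := J.jmul c c = c

/-- `c` is a primitive idempotent. -/
def IsPrimitive (J : EJA E) (c : E) : Prop :=
  J.IsIdempotent c ∧ c ≠ 0 ∧
    ∀ a b : E, J.IsIdempotent a → J.IsIdempotent b → a ≠ 0 → b ≠ 0 →
      J.jmul a b = 0 → c ≠ a + b

/-- A Jordan frame: primitive idempotents, pairwise orthogonal (w.r.t. the
Jordan product), summing to the unit. -/
def IsJordanFrame (J : EJA E) (c : Fin J.rank → E) : Prop :=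
  (∀ i, J.IsPrimitive (c i)) ∧ (∀ i j, i ≠ j → J.jmul (c i) (c j) = 0) ∧
    (∑ i, c i) = J.unit

/-- The symmetric cone: the cone of squares of the algebra. -/
def K (J : EJA E) : Set E := {z : E | ∃ y : E, z = J.jmul y y}

/-- `y` has rank `k`: some spectral decomposition of `y` has exactly `k`
nonzero eigenvalues.  (By uniqueness of eigenvalues this is well-defined.) -/
def HasRank (J : EJA E) (y : E) (k : ℕ) : Prop :=
  ∃ (c : Fin J.rank → E) (σ : Fin J.rank → ℝ),
    J.IsJordanFrame c ∧ y = ∑ i, σ i • c i ∧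
      (Finset.univ.filter (fun i => σ i ≠ 0)).card = k

/-- `t` is an eigenvalue of `y`. -/
def IsEigenvalue (J : EJA E) (y : E) (t : ℝ) : Prop :=
  ∃ (c : Fin J.rank → E) (σ : Fin J.rank → ℝ) (i : Fin J.rank),
    J.IsJordanFrame c ∧ y = ∑ j, σ j • c j ∧ σ i = t

/-- `p` is a nearest point of the symmetric cone `K` to `v`. -/
def IsProj (J : EJA E) (v p : E) : Prop :=
  p ∈ J.K ∧ ∀ z ∈ J.K, ‖v - p‖ ≤ ‖v - z‖

/-- A (linear subspace that is a) subalgebra. -/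
def IsSubalgebra (J : EJA E) (V : Submodule ℝ E) : Prop :=
  ∀ a ∈ V, ∀ b ∈ V, J.jmul a b ∈ V

/-- The algebra is simple: it is not the direct sum of two nonzero
subalgebras. -/
def IsSimple (J : EJA E) : Prop :=
  ¬ ∃ V W : Submodule ℝ E, J.IsSubalgebra V ∧ J.IsSubalgebra W ∧
      V ≠ ⊥ ∧ W ≠ ⊥ ∧ V ⊓ W = ⊥ ∧ V ⊔ W = ⊤

/-- The tangent cone of the convex set `K` at `z`:
the closure of `⋃_{t>0} t (K - z)`. -/
def tangentCone (J : EJA E) (z : E) : Set E :=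
  closure {d : E | ∃ t : ℝ, 0 < t ∧ ∃ k ∈ J.K, d = t • (k - z)}

/-- The lineality space `T_K(z) ∩ (-T_K(z))` of the tangent cone. -/
def linTangent (J : EJA E) (z : E) : Set E :=
  {d : E | d ∈ J.tangentCone z ∧ -d ∈ J.tangentCone z}

/-- The Lagrangian of problem (P1):
`L(x, μ, λ) = f(x) - ⟪h(x), μ⟫ - ⟪g(x), λ⟫`. -/
def lagr {n m : ℕ} (f : EuclideanSpace ℝ (Fin n) → ℝ)
    (h : EuclideanSpace ℝ (Fin n) → EuclideanSpace ℝ (Fin m))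
    (g : EuclideanSpace ℝ (Fin n) → E) (μ : EuclideanSpace ℝ (Fin m)) (lam : E)
    (x : EuclideanSpace ℝ (Fin n)) : ℝ :=
  f x - ⟪h x, μ⟫ - ⟪g x, lam⟫

/-- The Lagrangian of the slack-variable problem (P2), as a function of the
pair `(x, y)`. -/
def lagrSlack (J : EJA E) {n m : ℕ} (f : EuclideanSpace ℝ (Fin n) → ℝ)
    (h : EuclideanSpace ℝ (Fin n) → EuclideanSpace ℝ (Fin m))
    (g : EuclideanSpace ℝ (Fin n) → E) (μ : EuclideanSpace ℝ (Fin m)) (lam : E)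
    (p : EuclideanSpace ℝ (Fin n) × E) : ℝ :=
  f p.1 - ⟪h p.1, μ⟫ - ⟪g p.1 - J.jmul p.2 p.2, lam⟫

/-- `(x, μ, lam)` is a KKT triple of problem (P1). -/
def KKTP1 (J : EJA E) {n m : ℕ} (f : EuclideanSpace ℝ (Fin n) → ℝ)
    (h : EuclideanSpace ℝ (Fin n) → EuclideanSpace ℝ (Fin m))
    (g : EuclideanSpace ℝ (Fin n) → E)
    (x : EuclideanSpace ℝ (Fin n)) (μ : EuclideanSpace ℝ (Fin m)) (lam : E) : Prop :=
  gradient f x - (fderiv ℝ h x).adjoint μ - (fderiv ℝ g x).adjoint lam = 0 ∧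
    lam ∈ J.K ∧ g x ∈ J.K ∧ J.jmul lam (g x) = 0 ∧ h x = 0

/-- `(x, y, μ, lam)` is a KKT quadruple of the slack-variable problem (P2). -/
def KKTP2 (J : EJA E) {n m : ℕ} (f : EuclideanSpace ℝ (Fin n) → ℝ)
    (h : EuclideanSpace ℝ (Fin n) → EuclideanSpace ℝ (Fin m))
    (g : EuclideanSpace ℝ (Fin n) → E)
    (x : EuclideanSpace ℝ (Fin n)) (y : E) (μ : EuclideanSpace ℝ (Fin m))
    (lam : E) : Prop :=
  gradient f x - (fderiv ℝ h x).adjoint μ - (fderiv ℝ g x).adjoint lam = 0 ∧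
    J.jmul lam y = 0 ∧ g x = J.jmul y y ∧ h x = 0

/-- The augmented Lagrangian of the slack-variable problem (P2). -/
def augSlack (J : EJA E) {n m : ℕ} (f : EuclideanSpace ℝ (Fin n) → ℝ)
    (h : EuclideanSpace ℝ (Fin n) → EuclideanSpace ℝ (Fin m))
    (g : EuclideanSpace ℝ (Fin n) → E) (ρ : ℝ) (μ : EuclideanSpace ℝ (Fin m))
    (lam : E) (x : EuclideanSpace ℝ (Fin n)) (y : E) : ℝ :=
  f x - ⟪h x, μ⟫ + ρ / 2 * ‖h x‖ ^ 2 - ⟪g x - J.jmul y y, lam⟫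
    + ρ / 2 * ‖g x - J.jmul y y‖ ^ 2

/-- The augmented Lagrangian of problem (P1), where `P` is the metric
projection onto the symmetric cone `K`. -/
def augSym (J : EJA E) {n m : ℕ} (f : EuclideanSpace ℝ (Fin n) → ℝ)
    (h : EuclideanSpace ℝ (Fin n) → EuclideanSpace ℝ (Fin m))
    (g : EuclideanSpace ℝ (Fin n) → E) (P : E → E) (ρ : ℝ)
    (μ : EuclideanSpace ℝ (Fin m)) (lam : E)
    (x : EuclideanSpace ℝ (Fin n)) : ℝ :=
  f x - ⟪h x, μ⟫ + ρ / 2 * ‖h x‖ ^ 2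
    + 1 / (2 * ρ) * (-‖lam‖ ^ 2 + ‖P (lam - ρ • g x)‖ ^ 2)

end EJA

namespace EJA

section Idempotent

variable {E : Type*} [NormedAddCommGroup E] [InnerProductSpace ℝ E]
  [FiniteDimensional ℝ E] (J : EJA E)

/-- The Jordan identity, linearized once: `[L(w), L(y²)] + 2 [L(y), L(y ∘ w)] = 0`. -/
theorem jordan_linearized (y w z : E) :
    J.jmul w (J.jmul (J.jmul y y) z) - J.jmul (J.jmul y y) (J.jmul w z) +
      (2 : ℝ) • (J.jmul y (J.jmul (J.jmul y w) z) - J.jmul (J.jmul y w) (J.jmul y z)) = 0 := by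
  have h₁ := J.jordan (y + w) z
  have h₂ := J.jordan (y - w) z
  have h₃ := J.jordan w z
  simp only [map_add, map_sub, LinearMap.add_apply, LinearMap.sub_apply, J.comm w y] at h₁ h₂
  linear_combination (norm := module) (1 / 2 : ℝ) • h₁ - (1 / 2 : ℝ) • h₂ - h₃

/-- Multiplication by an idempotent is annihilated by `t (2t² - 3t + 1)`. -/
theorem IsIdempotent.peirce {J : EJA E} {c : E} (hc : J.IsIdempotent c) (w : E) :
    J.jmul c w - (3 : ℝ) • J.jmul c (J.jmul c w) +
      (2 : ℝ) • J.jmul c (J.jmul c (J.jmul c w)) = 0 := by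
  have h := J.jordan_linearized c w c
  rw [IsIdempotent] at hc
  simp only [hc, J.comm (J.jmul c w) c, J.comm w c] at h
  linear_combination (norm := module) h

theorem inner_jmul_left (y z w : E) : ⟪J.jmul y z, w⟫ = ⟪z, J.jmul y w⟫ := by
  rw [J.comm, J.assoc_inner]

/-- The quadratic form of multiplication by an idempotent is a sum of squares. -/
theorem IsIdempotent.inner_jmul_self {J : EJA E} {c : E} (hc : J.IsIdempotent c) (w : E) :
    ⟪w, J.jmul c w⟫ =
      ‖J.jmul c w‖ ^ 2 + 4 * ‖J.jmul c w - J.jmul c (J.jmul c w)‖ ^ 2 := by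
  have h₁ := congrArg (fun v => ⟪w, v⟫) (hc.peirce w)
  have h₂ := congrArg (fun v => ⟪w, v⟫) (hc.peirce (J.jmul c w))
  simp only [inner_add_right, inner_sub_right, inner_smul_right, inner_zero_right] at h₁ h₂
  rw [← real_inner_self_eq_norm_sq, ← real_inner_self_eq_norm_sq]
  simp only [inner_sub_left, inner_sub_right, J.inner_jmul_left]
  linear_combination h₁ - 2 * h₂

theorem IsIdempotent.inner_jmul_self_nonneg {J : EJA E} {c : E} (hc : J.IsIdempotent c)
    (w : E) : 0 ≤ ⟪w, J.jmul c w⟫ := by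
  rw [hc.inner_jmul_self]
  positivity

theorem IsIdempotent.jmul_eq_zero_of_inner_eq_zero {J : EJA E} {c w : E}
    (hc : J.IsIdempotent c) (h : ⟪w, J.jmul c w⟫ = 0) : J.jmul c w = 0 := by
  rw [hc.inner_jmul_self] at h
  have h₀ : ‖J.jmul c w‖ ^ 2 = 0 := by
    nlinarith [sq_nonneg ‖J.jmul c w‖, sq_nonneg ‖J.jmul c w - J.jmul c (J.jmul c w)‖]
  simpa using h₀

/-- The Peirce zero-space of an idempotent is closed under squaring. -/
theorem IsIdempotent.jmul_sq_eq_zero {J : EJA E} {c w : E} (hc : J.IsIdempotent c)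
    (h : J.jmul c w = 0) : J.jmul c (J.jmul w w) = 0 := by
  have hl := J.jordan_linearized c w w
  rw [IsIdempotent] at hc
  simpa [hc, h] using hl

/-- An element of the symmetric cone annihilated by `s ∘ s` is annihilated by `s`. -/
theorem jmul_eq_zero_of_jmul_sq_eq_zero {u s : E} (hu : u ∈ J.K)
    (h : J.jmul u (J.jmul s s) = 0) : J.jmul u s = 0 := by
  obtain ⟨w, rfl⟩ := hu
  obtain ⟨c, σ, hid, -, -, horth, -, hs⟩ := J.spectral s
  have hcs (i) : J.jmul (c i) s = σ i • c i := by
    rw [hs, map_sum, Finset.sum_eq_single i]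
    · rw [map_smul, hid]
    · intro j _ hj
      rw [map_smul, horth i j hj.symm, smul_zero]
    · simp
  have hsq : J.jmul s s = ∑ i, σ i ^ 2 • c i := by
    nth_rewrite 1 [hs]
    simp only [map_sum, map_smul, LinearMap.sum_apply, LinearMap.smul_apply, hcs, smul_smul, sq]
  have hinner (i) : ⟪J.jmul w w, c i⟫ = ⟪w, J.jmul (c i) w⟫ := by
    rw [J.assoc_inner, J.comm]
  have hzero : ∑ i, σ i ^ 2 * ⟪w, J.jmul (c i) w⟫ = 0 := by
    have h' : ⟪J.jmul w w, J.jmul s s⟫ = 0 := by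
      rw [← J.unit_jmul (J.jmul w w), J.assoc_inner, h, inner_zero_right]
    simpa only [hsq, inner_sum, inner_smul_right, hinner] using h'
  rw [Finset.sum_eq_zero_iff_of_nonneg fun i _ => mul_nonneg (sq_nonneg _)
    (IsIdempotent.inner_jmul_self_nonneg (hid i) w)] at hzero
  rw [hs, map_sum]
  refine Finset.sum_eq_zero fun i hi => ?_
  rw [map_smul, smul_eq_zero]
  refine (mul_eq_zero.mp (hzero i hi)).imp (by simp) fun hw => ?_
  rw [J.comm]
  exact IsIdempotent.jmul_sq_eq_zero (hid i)
    (IsIdempotent.jmul_eq_zero_of_inner_eq_zero (hid i) hw)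

end Idempotent

end EJA

/-- a KKT triple of (P1) yields the KKT quadruple
`(x, √(g(x)), μ, λ)` of (P2); here `s = √(g(x))` is the unique square root of
`g(x)` lying in `K`. -/
theorem stmt7 {E : Type*} [NormedAddCommGroup E] [InnerProductSpace ℝ E]
    [FiniteDimensional ℝ E] (J : EJA E) {n m : ℕ}
    (f : EuclideanSpace ℝ (Fin n) → ℝ)
    (h : EuclideanSpace ℝ (Fin n) → EuclideanSpace ℝ (Fin m))
    (g : EuclideanSpace ℝ (Fin n) → E)
    (hf : ContDiff ℝ 2 f) (hh : ContDiff ℝ 2 h) (hg : ContDiff ℝ 2 g)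
    (x : EuclideanSpace ℝ (Fin n)) (μ : EuclideanSpace ℝ (Fin m)) (lam : E)
    (s : E) (hsK : s ∈ J.K) (hs : J.jmul s s = g x)
    (hKKT : J.KKTP1 f h g x μ lam) :
    J.KKTP2 f h g x s μ lam := by
  obtain ⟨hgrad, hlam, -, hcompl, hx⟩ := hKKT
  exact ⟨hgrad, J.jmul_eq_zero_of_jmul_sq_eq_zero hlam (hs ▸ hcompl), hs.symm, hx⟩
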